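/- arXiv:2009.03270 — 2 statements merged into one kernel-verified Lean document; each statement's English description precedes it below -/
import Mathlib

section
/- (Schanuel's lemma for semi-U-V replacements, cokernel version) Let A be a Grothendieck abelian category and (U,V) a complete hereditary cotorsion pair. If W and W′ are semi-U-V complexes connected by a homotopy equivalence α : W → W′, then for every integer n there exist objects X, X′ ∈ U ∩ V with C_n(W) ⊕ X ≅ C_n(W′) ⊕ X′, where C_n denotes the cokernel of the differential into degree n. -/
open CategoryTheory Category Limits

universe v u

/-- `Ext¹(X,Y) = 0`, encoded as: every short exact sequence `0 → Y → E → X → 0` splits. -/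
def Ext1Vanishes {A : Type u} [Category.{v} A] [Abelian A] (X Y : A) : Prop :=
  ∀ (E : A) (f : Y ⟶ E) (g : E ⟶ X) (w : f ≫ g = 0),
    (ShortComplex.mk f g w).ShortExact → ∃ s : X ⟶ E, s ≫ g = 𝟙 X

/-- `(U,V)` is a cotorsion pair in the abelian category `A`. -/
def IsCotorsionPair {A : Type u} [Category.{v} A] [Abelian A] (U V : Set A) : Prop :=
  (∀ X, X ∈ U ↔ ∀ Y ∈ V, Ext1Vanishes X Y) ∧
  (∀ Y, Y ∈ V ↔ ∀ X ∈ U, Ext1Vanishes X Y)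

/-- `(U,V)` is a complete cotorsion pair. -/
def IsCompleteCotorsionPair {A : Type u} [Category.{v} A] [Abelian A] (U V : Set A) : Prop :=
  IsCotorsionPair U V ∧
  (∀ M : A, ∃ (V₀ U₀ : A) (f : V₀ ⟶ U₀) (g : U₀ ⟶ M) (w : f ≫ g = 0),
      V₀ ∈ V ∧ U₀ ∈ U ∧ (ShortComplex.mk f g w).ShortExact) ∧
  (∀ M : A, ∃ (V₀ U₀ : A) (f : M ⟶ V₀) (g : V₀ ⟶ U₀) (w : f ≫ g = 0),
      V₀ ∈ V ∧ U₀ ∈ U ∧ (ShortComplex.mk f g w).ShortExact)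

/-- Hereditary, via the standard closure characterization. -/
def IsHereditaryPair {A : Type u} [Category.{v} A] [Abelian A] (U V : Set A) : Prop :=
  (∀ (X' X X'' : A) (f : X' ⟶ X) (g : X ⟶ X'') (w : f ≫ g = 0),
      (ShortComplex.mk f g w).ShortExact → X ∈ U → X'' ∈ U → X' ∈ U) ∧
  (∀ (X' X X'' : A) (f : X' ⟶ X) (g : X ⟶ X'') (w : f ≫ g = 0),
      (ShortComplex.mk f g w).ShortExact → X' ∈ V → X ∈ V → X'' ∈ V)

/-- An `S`-acyclic complex: an acyclic complex of objects of `S` whose cycles lie in `S`. -/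
def SAcyclicComplex {A : Type u} [Category.{v} A] [Abelian A] (S : Set A)
    (C : CochainComplex A ℤ) : Prop :=
  (∀ n, C.X n ∈ S) ∧ (∀ n, C.ExactAt n) ∧ (∀ n, C.cycles n ∈ S)

/-- The total Hom complex `Hom_A(C, W)` is acyclic, encoded as: every chain map from `C`
to any shift of `W` is null-homotopic. -/
def HomComplexAcyclic {A : Type u} [Category.{v} A] [Abelian A]
    (C W : CochainComplex A ℤ) : Prop :=
  ∀ (k : ℤ) (f : C ⟶ W⟦k⟧), Nonempty (Homotopy f 0)

/-- A semi-`U`-`V` complex: all terms in `U ∩ V`, `Hom_A(C,W)` acyclic for every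
`V`-acyclic `C` and `Hom_A(W,D)` acyclic for every `U`-acyclic `D`. -/
def SemiUV {A : Type u} [Category.{v} A] [Abelian A] (U V : Set A)
    (W : CochainComplex A ℤ) : Prop :=
  (∀ n, W.X n ∈ U ∩ V) ∧
  (∀ C : CochainComplex A ℤ, SAcyclicComplex V C → HomComplexAcyclic C W) ∧
  (∀ D : CochainComplex A ℤ, SAcyclicComplex U D → HomComplexAcyclic W D)

section Ext1

variable {A : Type u} [Category.{v} A] [Abelian A]

theorem Ext1Vanishes.exists_lift {X Y E Z : A} (h : Ext1Vanishes X Y)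
    {f : Y ⟶ E} {g : E ⟶ Z} {w : f ≫ g = 0} (hS : (ShortComplex.mk f g w).ShortExact)
    (r : X ⟶ Z) : ∃ s : X ⟶ E, s ≫ g = r := by
  have : Mono f := hS.mono_f
  have : Epi g := hS.epi_g
  have wl : f ≫ g = 0 ≫ r := by rw [w, zero_comp]
  have w' : pullback.lift f 0 wl ≫ pullback.snd g r = 0 := pullback.lift_snd _ _ _
  have : Mono (pullback.lift f 0 wl) := mono_of_mono_fac (pullback.lift_fst f 0 wl)
  have hT : (ShortComplex.mk _ _ w').ShortExact := by
    refine ShortComplex.ShortExact.mk (ShortComplex.exact_of_f_is_kernel _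
      (KernelFork.IsLimit.ofι' _ _ fun {T} k hk => ?_))
    dsimp at k hk
    have hk' : (k ≫ pullback.fst g r) ≫ g = 0 := by
      rw [assoc, pullback.condition, reassoc_of% hk, zero_comp]
    refine ⟨hS.exact.lift _ hk', ?_⟩
    apply pullback.hom_ext
    · exact (assoc _ _ _).trans ((congrArg (hS.exact.lift _ hk' ≫ ·)
        (pullback.lift_fst f 0 wl)).trans (hS.exact.lift_f _ hk'))
    · exact (assoc _ _ _).trans ((congrArg (hS.exact.lift _ hk' ≫ ·) w').trans
        (comp_zero.trans hk.symm))
  obtain ⟨s, hs⟩ := h _ _ _ w' hT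
  exact ⟨s ≫ pullback.fst g r, by rw [assoc, pullback.condition, reassoc_of% hs]⟩

theorem Ext1Vanishes.exists_extension {X Y E Z : A} (h : Ext1Vanishes X Y)
    {f : Z ⟶ E} {g : E ⟶ X} {w : f ≫ g = 0} (hS : (ShortComplex.mk f g w).ShortExact)
    (r : Z ⟶ Y) : ∃ s : E ⟶ Y, f ≫ s = r := by
  have : Mono f := hS.mono_f
  have : Epi g := hS.epi_g
  have wl : f ≫ g = r ≫ 0 := by rw [w, comp_zero]
  have w' : pushout.inr f r ≫ pushout.desc g 0 wl = 0 := pushout.inr_desc _ _ _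
  have : Epi (pushout.desc g 0 wl) := epi_of_epi_fac (pushout.inl_desc g 0 wl)
  have hT : (ShortComplex.mk _ _ w').ShortExact := by
    refine ShortComplex.ShortExact.mk (ShortComplex.exact_of_g_is_cokernel _
      (CokernelCofork.IsColimit.ofπ' _ _ fun {T} k hk => ?_))
    dsimp at k hk
    have hk' : f ≫ pushout.inl f r ≫ k = 0 := by
      rw [pushout.condition_assoc, hk, comp_zero]
    refine ⟨hS.exact.desc _ hk', ?_⟩
    apply pushout.hom_ext
    · exact (assoc _ _ _).symm.trans ((congrArg (· ≫ hS.exact.desc _ hk')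
        (pushout.inl_desc g 0 wl)).trans (hS.exact.g_desc _ hk'))
    · exact (assoc _ _ _).symm.trans ((congrArg (· ≫ hS.exact.desc _ hk') w').trans
        (zero_comp.trans hk.symm))
  obtain ⟨s, hs⟩ := h _ _ _ w' hT
  have σ := ShortComplex.Splitting.ofExactOfSection _ hT.exact s hs hT.mono_f
  exact ⟨pushout.inl f r ≫ σ.r, by
    rw [pushout.condition_assoc]
    exact (congrArg (r ≫ ·) σ.f_r).trans (comp_id r)⟩

/-- If the identity of `K` factors through `P ⊞ Q` and `P`, `Q` belong to both classes of
a cotorsion pair, so does `K`. -/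
theorem IsCotorsionPair.mem_inter_of_id_eq_add {U V : Set A} (h : IsCotorsionPair U V)
    {K P Q : A} (hP : P ∈ U ∩ V) (hQ : Q ∈ U ∩ V)
    (a : K ⟶ P) (b : P ⟶ K) (c : K ⟶ Q) (d : Q ⟶ K) (hid : a ≫ b + c ≫ d = 𝟙 K) :
    K ∈ U ∩ V := by
  constructor
  · rw [h.1]
    intro Y hY E f g w hS
    obtain ⟨b', hb⟩ := ((h.1 P).1 hP.1 Y hY).exists_lift hS b
    obtain ⟨d', hd⟩ := ((h.1 Q).1 hQ.1 Y hY).exists_lift hS d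
    exact ⟨a ≫ b' + c ≫ d', by simp [hb, hd, hid]⟩
  · rw [h.2]
    intro X hX E f g w hS
    obtain ⟨a', ha⟩ := ((h.2 P).1 hP.2 X hX).exists_extension hS a
    obtain ⟨c', hc⟩ := ((h.2 Q).1 hQ.2 X hX).exists_extension hS c
    let σ := ShortComplex.Splitting.ofExactOfRetraction _ hS.exact (a' ≫ b + c' ≫ d)
      (by simp [reassoc_of% ha, reassoc_of% hc, hid]) hS.epi_g
    exact ⟨σ.s, σ.s_g⟩

/-- Objects that are isomorphic modulo maps factoring through `U ∩ V` become isomorphic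
after adding objects of `U ∩ V`. -/
theorem IsCotorsionPair.exists_biprod_iso {U V : Set A} (h : IsCotorsionPair U V)
    {C C' P P' : A} (hP : P ∈ U ∩ V) (hP' : P' ∈ U ∩ V)
    (f : C ⟶ C') (g : C' ⟶ C) (u : C ⟶ P) (v : P ⟶ C) (u' : C' ⟶ P') (v' : P' ⟶ C')
    (hC : f ≫ g + u ≫ v = 𝟙 C) (hC' : g ≫ f + u' ≫ v' = 𝟙 C') :
    ∃ X X' : A, X ∈ U ∩ V ∧ X' ∈ U ∩ V ∧ Nonempty ((C ⊞ X) ≅ (C' ⊞ X')) := by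
  have hr : biprod.lift f u ≫ biprod.desc g v = 𝟙 C := by rw [biprod.lift_desc, hC]
  have : IsSplitMono (biprod.lift f u) := ⟨⟨⟨_, hr⟩⟩⟩
  let S := ShortComplex.mk _ _ (cokernel.condition (biprod.lift f u))
  have hS : S.Exact := ShortComplex.exact_cokernel _
  let σ : S.Splitting := ShortComplex.Splitting.ofExactOfRetraction S hS
    (biprod.desc g v) hr inferInstance
  refine ⟨S.X₃, P, ?_, hP, ⟨σ.isoBinaryBiproduct.symm⟩⟩
  let ι : S.X₃ ⟶ C' ⊞ P := σ.s
  let π : C' ⊞ P ⟶ S.X₃ := S.g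
  have hιπ : ι ≫ π = 𝟙 _ := σ.s_g
  have hιr : (ι ≫ biprod.fst) ≫ g = -((ι ≫ biprod.snd) ≫ v) := by
    have : ι ≫ biprod.desc g v = 0 := σ.s_r
    rw [biprod.desc_eq, Preadditive.comp_add] at this
    simpa using eq_neg_of_add_eq_zero_left this
  refine h.mem_inter_of_id_eq_add hP' hP ((ι ≫ biprod.fst) ≫ u') (v' ≫ biprod.inl ≫ π)
    (ι ≫ biprod.snd) (biprod.inr ≫ π - v ≫ f ≫ biprod.inl ≫ π) ?_
  calc
    _ = (ι ≫ biprod.fst) ≫ (𝟙 C' - g ≫ f) ≫ biprod.inl ≫ π +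
        ((ι ≫ biprod.snd) ≫ biprod.inr ≫ π -
          ((ι ≫ biprod.snd) ≫ v) ≫ f ≫ biprod.inl ≫ π) := by
      rw [← hC']
      simp
    _ = ι ≫ (biprod.fst ≫ biprod.inl + biprod.snd ≫ biprod.inr) ≫ π := by
      rw [Preadditive.sub_comp, Preadditive.comp_sub, assoc g f, ← assoc _ g, hιr]
      simp only [Preadditive.neg_comp, Preadditive.add_comp, Preadditive.comp_add, id_comp,
        assoc]
      abel
    _ = 𝟙 _ := by rw [biprod.total, id_comp, hιπ]

/-- A map homotopic to the identity induces on `opcycles n` the identity up to a map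
factoring through the term of degree `n + 1`. -/
theorem Homotopy.exists_opcyclesMap_add_eq_id {C : CochainComplex A ℤ} {φ : C ⟶ C}
    (h : Homotopy φ (𝟙 C)) (n : ℤ) :
    ∃ (u : C.opcycles n ⟶ C.X (n + 1)) (v : C.X (n + 1) ⟶ C.opcycles n),
      HomologicalComplex.opcyclesMap φ n + u ≫ v = 𝟙 _ := by
  refine ⟨C.fromOpcycles n (n + 1), -(h.hom (n + 1) n ≫ C.pOpcycles n), ?_⟩
  rw [← cancel_epi (C.pOpcycles n)]
  have hn := h.comm n
  rw [dNext_eq h.hom (show (ComplexShape.up ℤ).Rel n (n + 1) by simp),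
    prevD_eq h.hom (show (ComplexShape.up ℤ).Rel (n - 1) n by simp)] at hn
  simp [hn]

end Ext1

/-- Schanuel's lemma for semi-`U`-`V` replacements (cokernel version): if `W` and `W′` are
semi-`U`-`V` complexes connected by a homotopy equivalence, then for every `n` there are
objects `X, X′ ∈ U ∩ V` with `C_n(W) ⊕ X ≅ C_n(W′) ⊕ X′`, where `C_n` is the cokernel of
the differential into degree `n` (i.e. `opcycles`). -/
theorem stmt10 {A : Type u} [Category.{v} A] [Abelian A]
    [HasFilteredColimits A] [AB5 A] (G : A) (hG : IsSeparator G)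
    (U V : Set A) (hpair : IsCompleteCotorsionPair U V) (hher : IsHereditaryPair U V)
    (W W' : CochainComplex A ℤ) (hW : SemiUV U V W) (hW' : SemiUV U V W')
    (α : HomotopyEquiv W W') (n : ℤ) :
    ∃ X X' : A, X ∈ U ∩ V ∧ X' ∈ U ∩ V ∧
      Nonempty ((W.opcycles n ⊞ X) ≅ (W'.opcycles n ⊞ X')) := by
  obtain ⟨u, v, huv⟩ := α.homotopyHomInvId.exists_opcyclesMap_add_eq_id n
  obtain ⟨u', v', huv'⟩ := α.homotopyInvHomId.exists_opcyclesMap_add_eq_id n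
  rw [HomologicalComplex.opcyclesMap_comp] at huv huv'
  exact hpair.1.exists_biprod_iso (hW.1 _) (hW'.1 _) _ _ u v u' v' huv huv'
end

section
/- Let A be a commutative noetherian ring. If every cotorsion A-module has finite Gorenstein flat dimension, then every A-module has finite Gorenstein flat dimension. More precisely (module-level ingredient): given a short exact sequence of A-modules 0 → M → C → F → 0 with F flat and C of finite Gorenstein flat dimension, M has finite Gorenstein flat dimension. -/
open CategoryTheory Category Limits MonoidalCategory

universe u

/-- A module `G` is Gorenstein flat if it is (isomorphic to) a cycle module of an acyclic
complex `T` of flat modules such that `I ⊗ T` is acyclic for every injective module `I`. -/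
def IsGorensteinFlat (R : Type u) [CommRing R] (G : ModuleCat.{u} R) : Prop :=
  ∃ T : ChainComplex (ModuleCat.{u} R) ℤ,
    (∀ n, Module.Flat R (T.X n)) ∧
    (∀ n, T.ExactAt n) ∧
    (∀ I : ModuleCat.{u} R, Injective I →
      ∀ n, ((((tensorLeft I).mapHomologicalComplex
        (ComplexShape.down ℤ)).obj T).ExactAt n)) ∧
    Nonempty (T.cycles 0 ≅ G)

/-- `M` has Gorenstein flat dimension at most `n`. -/
def GFdimLE (R : Type u) [CommRing R] : ℕ → ModuleCat.{u} R → Prop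
  | 0, M => IsGorensteinFlat R M
  | n + 1, M => ∃ (K G : ModuleCat.{u} R) (f : K ⟶ G) (g : G ⟶ M) (w : f ≫ g = 0),
      IsGorensteinFlat R G ∧ (ShortComplex.mk f g w).ShortExact ∧ GFdimLE R n K

/-- `C` is a cotorsion module: every extension of `C` by a flat module splits
(`Ext¹(F,C) = 0` for all flat `F`). -/
def IsCotorsionModule (R : Type u) [CommRing R] (C : ModuleCat.{u} R) : Prop :=
  ∀ (F E : ModuleCat.{u} R) (f : C ⟶ E) (g : E ⟶ F) (w : f ≫ g = 0),
    Module.Flat R F → (ShortComplex.mk f g w).ShortExact → ∃ s : F ⟶ E, s ≫ g = 𝟙 F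

section ShortExactSequences

variable {R : Type u} [CommRing R]

/-- There is a short exact sequence `0 → A → B → C → 0`. -/
def Ses (A B C : ModuleCat.{u} R) : Prop :=
  ∃ (f : A →ₗ[R] B) (g : B →ₗ[R] C),
    Function.Injective f ∧ Function.Exact f g ∧ Function.Surjective g

lemma ModuleCat.shortExact_of_linearMap {A B C : ModuleCat.{u} R} {f : A →ₗ[R] B}
    {g : B →ₗ[R] C} (hf : Function.Injective f) (he : Function.Exact f g)
    (hg : Function.Surjective g) :
    (ShortComplex.mk (ModuleCat.ofHom f) (ModuleCat.ofHom g)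
      (by ext x; exact he.apply_apply_eq_zero x)).ShortExact :=
  ModuleCat.shortComplex_shortExact _ he hf hg

lemma Ses.of_shortExact {A B C : ModuleCat.{u} R} {f : A ⟶ B} {g : B ⟶ C} {w : f ≫ g = 0}
    (h : (ShortComplex.mk f g w).ShortExact) : Ses A B C :=
  ⟨f.hom, g.hom, h.moduleCat_injective_f,
    (ShortComplex.ShortExact.moduleCat_exact_iff_function_exact _).1 h.exact,
    h.moduleCat_surjective_g⟩

lemma Ses.exists_shortExact {A B C : ModuleCat.{u} R} (h : Ses A B C) :
    ∃ (f : A ⟶ B) (g : B ⟶ C) (w : f ≫ g = 0), (ShortComplex.mk f g w).ShortExact := by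
  obtain ⟨f, g, hf, he, hg⟩ := h
  exact ⟨_, _, _, ModuleCat.shortExact_of_linearMap hf he hg⟩

lemma Ses.of_injective {A B : ModuleCat.{u} R} {f : A →ₗ[R] B} (hf : Function.Injective f) :
    Ses A B (ModuleCat.of R (B ⧸ LinearMap.range f)) :=
  ⟨f, (LinearMap.range f).mkQ, hf, LinearMap.exact_map_mkQ_range f, Submodule.mkQ_surjective _⟩

lemma Ses.of_surjective {B C : ModuleCat.{u} R} {g : B →ₗ[R] C} (hg : Function.Surjective g) :
    Ses (ModuleCat.of R (LinearMap.ker g)) B C :=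
  ⟨(LinearMap.ker g).subtype, g, Subtype.val_injective, LinearMap.exact_subtype_ker_map g, hg⟩

/-- The quotients of a chain of monomorphisms `A → B → T` form a short exact sequence. -/
lemma Ses.exists_quotient_of_comp {A B C T D : ModuleCat.{u} R} (h₁ : Ses A B C) (h₂ : Ses B T D) :
    ∃ Q : ModuleCat.{u} R, Ses A T Q ∧ Ses C Q D := by
  obtain ⟨f, g, hf, he, hg⟩ := h₁
  obtain ⟨f', g', hf', he', hg'⟩ := h₂
  have hinj : Function.Injective (f' ∘ₗ f) := by simpa using hf'.comp hf
  refine ⟨_, Ses.of_injective hinj, ?_⟩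
  let P := LinearMap.range (f' ∘ₗ f)
  have hker : ∀ b, g b = 0 ↔ P.mkQ (f' b) = 0 := by
    intro b
    rw [he b]
    simp only [Submodule.mkQ_apply, Submodule.Quotient.mk_eq_zero, P, LinearMap.mem_range,
      LinearMap.comp_apply, Set.mem_range]
    exact exists_congr fun x => hf'.eq_iff.symm
  let e := g.quotKerEquivOfSurjective hg
  let i : C →ₗ[R] T ⧸ P := ((LinearMap.ker g).liftQ (P.mkQ ∘ₗ f')
    (fun b hb => (hker b).1 hb)) ∘ₗ e.symm.toLinearMap
  have hi : ∀ b, i (g b) = P.mkQ (f' b) := by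
    intro b
    have : e.symm (g b) = Submodule.Quotient.mk b := by
      rw [LinearEquiv.symm_apply_eq]; rfl
    simp only [i, LinearMap.comp_apply, LinearEquiv.coe_coe, this]
    rfl
  let q : T ⧸ P →ₗ[R] D := P.liftQ g' (by
    rintro _ ⟨x, rfl⟩; exact he'.apply_apply_eq_zero _)
  have hq : ∀ t, q (P.mkQ t) = g' t := fun t => rfl
  refine ⟨i, q, ?_, ?_, ?_⟩
  · rw [injective_iff_map_eq_zero]
    intro c hc
    obtain ⟨b, rfl⟩ := hg c
    rw [hi] at hc
    exact (hker b).2 hc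
  · intro x
    obtain ⟨t, rfl⟩ := P.mkQ_surjective x
    rw [hq, he' t]
    constructor
    · rintro ⟨b, rfl⟩; exact ⟨g b, hi b⟩
    · rintro ⟨c, hc⟩
      obtain ⟨b, rfl⟩ := hg c
      rw [hi, ← sub_eq_zero, ← map_sub] at hc
      obtain ⟨a, ha⟩ := (Submodule.Quotient.mk_eq_zero _).1 hc
      refine ⟨b - f a, ?_⟩
      simp only [LinearMap.comp_apply] at ha
      rw [map_sub, ha]; abel
  · intro d
    obtain ⟨t, rfl⟩ := hg' d
    exact ⟨P.mkQ t, hq t⟩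

/-- The kernels of a chain of epimorphisms `G → C → F` form a short exact sequence. -/
lemma Ses.exists_kernel_of_comp {K G C M F : ModuleCat.{u} R} (h₁ : Ses K G C) (h₂ : Ses M C F) :
    ∃ G' : ModuleCat.{u} R, Ses K G' M ∧ Ses G' G F := by
  obtain ⟨f, g, hf, he, hg⟩ := h₁
  obtain ⟨f', g', hf', he', hg'⟩ := h₂
  refine ⟨_, ?_, Ses.of_surjective (g := g' ∘ₗ g) (by simpa using hg'.comp hg)⟩
  let N := LinearMap.ker (g' ∘ₗ g)
  have hmem : ∀ k, f k ∈ N := fun k => by simp [N, he.apply_apply_eq_zero]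
  let e := LinearEquiv.ofInjective f' hf'
  let p : N →ₗ[R] M := e.symm.toLinearMap ∘ₗ (g ∘ₗ N.subtype).codRestrict (LinearMap.range f')
    (fun x => (he' _).1 x.2)
  have hp : ∀ x, f' (p x) = g x := fun x => by
    have := congrArg Subtype.val (e.apply_symm_apply
      ((g ∘ₗ N.subtype).codRestrict (LinearMap.range f') (fun x => (he' _).1 x.2) x))
    exact this
  refine ⟨f.codRestrict N hmem, p, ?_, ?_, ?_⟩
  · intro x y hxy
    exact hf (congrArg Subtype.val hxy)
  · intro x
    rw [← hf'.eq_iff, hp, map_zero, he]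
    constructor
    · rintro ⟨k, hk⟩; exact ⟨k, Subtype.ext hk⟩
    · rintro ⟨k, hk⟩; exact ⟨k, congrArg Subtype.val hk⟩
  · intro m
    obtain ⟨x, hx⟩ := hg (f' m)
    refine ⟨⟨x, ?_⟩, hf' ?_⟩
    · simp [hx, he'.apply_apply_eq_zero]
    · rw [hp]; exact hx

/-- The pushout of a short exact sequence along a monomorphism. -/
lemma Ses.exists_pushout {A B C A' A'' : ModuleCat.{u} R} (h₁ : Ses A B C) (h₂ : Ses A A' A'') :
    ∃ Y : ModuleCat.{u} R, Ses A' Y C ∧ Ses B Y A'' := by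
  obtain ⟨f, g, hf, he, hg⟩ := h₁
  obtain ⟨f', g', hf', he', hg'⟩ := h₂
  let d : A →ₗ[R] A' × B := f'.prod (-f)
  let P := LinearMap.range d
  have hP : ∀ a b, P.mkQ (a, b) = 0 ↔ ∃ x, f' x = a ∧ f x = -b := by
    intro a b
    rw [Submodule.mkQ_apply, Submodule.Quotient.mk_eq_zero]
    refine exists_congr fun x => ?_
    change (f' x, -f x) = (a, b) ↔ _
    rw [Prod.mk.injEq, neg_eq_iff_eq_neg]
  let qC : (A' × B) ⧸ P →ₗ[R] C := P.liftQ (g ∘ₗ LinearMap.snd R A' B) (by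
    rintro _ ⟨x, rfl⟩; simp [d, he.apply_apply_eq_zero])
  let qA : (A' × B) ⧸ P →ₗ[R] A'' := P.liftQ (g' ∘ₗ LinearMap.fst R A' B) (by
    rintro _ ⟨x, rfl⟩; simp [d, he'.apply_apply_eq_zero])
  have hqC : ∀ a b, qC (P.mkQ (a, b)) = g b := fun a b => rfl
  have hqA : ∀ a b, qA (P.mkQ (a, b)) = g' a := fun a b => rfl
  have key : ∀ x, P.mkQ (f' x, 0) = P.mkQ (0, f x) := fun x => by
    rw [← sub_eq_zero, ← map_sub]
    exact (hP _ _).2 ⟨x, by simp, by simp⟩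
  refine ⟨ModuleCat.of R ((A' × B) ⧸ P), ⟨P.mkQ ∘ₗ LinearMap.inl R A' B, qC, ?_, ?_, ?_⟩,
    ⟨P.mkQ ∘ₗ LinearMap.inr R A' B, qA, ?_, ?_, ?_⟩⟩
  · rw [injective_iff_map_eq_zero]
    intro a ha
    obtain ⟨x, rfl, hx⟩ := (hP a 0).1 ha
    rw [neg_zero, map_eq_zero_iff f hf] at hx
    simp [hx]
  · intro y
    obtain ⟨⟨a, b⟩, rfl⟩ := P.mkQ_surjective y
    rw [hqC, he]
    constructor
    · rintro ⟨x, rfl⟩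
      refine ⟨a + f' x, ?_⟩
      change P.mkQ (a + f' x, 0) = _
      rw [show ((a + f' x, 0) : A' × B) = (a, 0) + (f' x, 0) by simp, map_add, key, ← map_add]
      simp
    · rintro ⟨a', ha'⟩
      change P.mkQ (a', 0) = _ at ha'
      rw [← sub_eq_zero, ← map_sub] at ha'
      obtain ⟨x, -, hx⟩ := (hP _ _).1 ha'
      exact ⟨x, by simpa using hx⟩
  · intro c
    obtain ⟨b, rfl⟩ := hg c
    exact ⟨P.mkQ (0, b), rfl⟩
  · rw [injective_iff_map_eq_zero]
    intro b hb
    obtain ⟨x, hx, hb⟩ := (hP 0 b).1 hb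
    rw [map_eq_zero_iff f' hf'] at hx
    simpa [hx] using hb
  · intro y
    obtain ⟨⟨a, b⟩, rfl⟩ := P.mkQ_surjective y
    rw [hqA, he']
    constructor
    · rintro ⟨x, rfl⟩
      refine ⟨b + f x, ?_⟩
      change P.mkQ (0, b + f x) = _
      rw [show ((0, b + f x) : A' × B) = (0, b) + (0, f x) by simp, map_add, ← key, ← map_add]
      simp
    · rintro ⟨b', hb'⟩
      change P.mkQ (0, b') = _ at hb'
      rw [← sub_eq_zero, ← map_sub] at hb'
      obtain ⟨x, hx, -⟩ := (hP _ _).1 hb'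
      exact ⟨-x, by simp only [zero_sub] at hx; rw [map_neg, hx]; simp⟩
  · intro c
    obtain ⟨a, rfl⟩ := hg' c
    exact ⟨P.mkQ (a, 0), rfl⟩

/-- A homomorphism `X → J` extending `F → J` embeds `X` into `J × G`, where `G = X / F`. -/
lemma Ses.of_extension {F X G J D : ModuleCat.{u} R} {i : F →ₗ[R] X} {p : X →ₗ[R] G}
    (hip : Function.Exact i p) (hp : Function.Surjective p)
    {j : F →ₗ[R] J} {q : J →ₗ[R] D} (hj : Function.Injective j) (hjq : Function.Exact j q)
    (hq : Function.Surjective q) {e : X →ₗ[R] J} (he : ∀ x, e (i x) = j x) :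
    Ses X (ModuleCat.of R (J × G)) D := by
  let ε := p.quotKerEquivOfSurjective hp
  let r : G →ₗ[R] D := ((LinearMap.ker p).liftQ (q ∘ₗ e) (fun x hx => by
    obtain ⟨y, rfl⟩ := (hip x).1 hx
    simp [he, hjq.apply_apply_eq_zero])) ∘ₗ ε.symm.toLinearMap
  have hr : ∀ x, r (p x) = q (e x) := by
    intro x
    have : ε.symm (p x) = Submodule.Quotient.mk x := by
      rw [LinearEquiv.symm_apply_eq]; rfl
    simp only [r, LinearMap.comp_apply, LinearEquiv.coe_coe, this]
    rfl
  refine ⟨e.prod p, q.coprod (-r), ?_, ?_, ?_⟩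
  · rw [injective_iff_map_eq_zero]
    intro x hx
    obtain ⟨h1, h2⟩ := Prod.mk.inj hx
    obtain ⟨y, rfl⟩ := (hip x).1 h2
    rw [he] at h1
    rw [(map_eq_zero_iff j hj).1 h1, map_zero]
  · rintro ⟨a, g⟩
    obtain ⟨x, rfl⟩ := hp g
    have : (q.coprod (-r)) (a, p x) = q (a - e x) := by simp [hr, sub_eq_add_neg]
    rw [this, hjq]
    constructor
    · rintro ⟨y, hy⟩
      refine ⟨x + i y, ?_⟩
      change (e (x + i y), p (x + i y)) = _
      rw [map_add, map_add, he, hy, hip.apply_apply_eq_zero]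
      simp
    · rintro ⟨x', hx'⟩
      obtain ⟨h1, h2⟩ := Prod.mk.inj hx'
      obtain ⟨y, hy⟩ := (hip (x' - x)).1 (by rw [map_sub, sub_eq_zero]; exact h2)
      refine ⟨y, ?_⟩
      rw [← he, hy, map_sub]
      exact congrArg (· - e x) h1
  · intro d
    obtain ⟨a, rfl⟩ := hq d
    exact ⟨(a, 0), by simp⟩

lemma Ses.prod_left {A B C : ModuleCat.{u} R} (J : ModuleCat.{u} R) (h : Ses A B C) :
    Ses (ModuleCat.of R (J × A)) (ModuleCat.of R (J × B)) C := by
  obtain ⟨f, g, hf, he, hg⟩ := h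
  refine ⟨LinearMap.id.prodMap f, g ∘ₗ LinearMap.snd R J B, ?_, ?_, ?_⟩
  · rintro ⟨a, b⟩ ⟨c, d⟩ h
    obtain ⟨h1, h2⟩ := Prod.mk.inj h
    exact Prod.ext h1 (hf h2)
  · rintro ⟨a, b⟩
    refine (he b).trans ?_
    constructor
    · rintro ⟨y, rfl⟩; exact ⟨(a, y), rfl⟩
    · rintro ⟨⟨a', y⟩, h⟩; exact ⟨y, (Prod.mk.inj h).2⟩
  · intro c
    obtain ⟨b, rfl⟩ := hg c
    exact ⟨(0, b), rfl⟩

/-- One step of the horseshoe lemma. -/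
lemma Ses.exists_horseshoe {M E Z K P : ModuleCat.{u} R} (h : Ses M E Z) (hK : Ses K P M)
    [Module.Projective R P] :
    ∃ K' P' K'' P'' : ModuleCat.{u} R, Module.Projective R P' ∧ Module.Projective R P'' ∧
      Ses K' P' E ∧ Ses K'' P'' Z ∧ Ses K K' K'' := by
  obtain ⟨f, g, hf, he, hg⟩ := h
  obtain ⟨k, p, hk, hkp, hp⟩ := hK
  let π : (Z →₀ R) →ₗ[R] Z := Finsupp.linearCombination R id
  have hπ : Function.Surjective π := Finsupp.linearCombination_id_surjective R Z
  obtain ⟨l, hl⟩ := Module.projective_lifting_property g π hg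
  have hl' : ∀ x, g (l x) = π x := fun x => LinearMap.congr_fun hl x
  let ρ : (P × (Z →₀ R)) →ₗ[R] E := (f ∘ₗ p).coprod l
  have hρ : Function.Surjective ρ := by
    intro e
    obtain ⟨x, hx⟩ := hπ (g e)
    obtain ⟨m, hm⟩ := (he (e - l x)).1 (by rw [map_sub, hl', hx, sub_self])
    obtain ⟨y, rfl⟩ := hp m
    exact ⟨(y, x), by simp [ρ, hm]⟩
  have hgρ : ∀ y x, g (ρ (y, x)) = π x := fun y x => by
    simp [ρ, hl', he.apply_apply_eq_zero]
  refine ⟨_, ModuleCat.of R (P × (Z →₀ R)), _, ModuleCat.of R (Z →₀ R), inferInstance,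
    inferInstance, Ses.of_surjective (g := ρ) hρ, Ses.of_surjective (g := π) hπ, ?_⟩
  refine ⟨(LinearMap.inl R P (Z →₀ R) ∘ₗ k).codRestrict (LinearMap.ker ρ) (fun x => by
      simp [ρ, hkp.apply_apply_eq_zero]),
    (LinearMap.snd R P (Z →₀ R) ∘ₗ (LinearMap.ker ρ).subtype).codRestrict (LinearMap.ker π)
      (fun x => ?_), ?_, ?_, ?_⟩
  · obtain ⟨⟨y, x⟩, hx⟩ := x
    change π x = 0
    rw [← hgρ y x, LinearMap.mem_ker.1 hx, map_zero]
  · intro x y hxy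
    exact hk (congrArg (fun z => z.1.1) hxy)
  · rintro ⟨⟨y, x⟩, hx⟩
    constructor
    · intro h0
      obtain rfl : x = 0 := congrArg Subtype.val h0
      have h1 : p y = 0 := hf (by simpa [ρ] using hx)
      obtain ⟨z, rfl⟩ := (hkp y).1 h1
      exact ⟨z, rfl⟩
    · rintro ⟨z, hz⟩
      exact Subtype.ext (congrArg (fun z => z.1.2) hz).symm
  · rintro ⟨x, hx⟩
    obtain ⟨m, hm⟩ := (he (l x)).1 (by rw [hl']; exact hx)
    obtain ⟨y, rfl⟩ := hp m
    refine ⟨⟨(-y, x), ?_⟩, rfl⟩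
    simp [ρ, hm]

end ShortExactSequences

section CharacterDuals

open CategoryTheory.Abelian

variable {R : Type u} [CommRing R]

/-- The character module, as an object of `ModuleCat R`. -/
abbrev charDual (M : ModuleCat.{u} R) : ModuleCat.{u} R := ModuleCat.of R (CharacterModule M)

lemma CharacterModule.dual_exact {A B C : Type u} [AddCommGroup A] [AddCommGroup B]
    [AddCommGroup C] [Module R A] [Module R B] [Module R C] {f : A →ₗ[R] B} {g : B →ₗ[R] C}
    (he : Function.Exact f g) (hg : Function.Surjective g) :
    Function.Exact (CharacterModule.dual g) (CharacterModule.dual f) := by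
  intro φ
  constructor
  · intro h
    have hker : g.toAddMonoidHom.ker ≤ AddMonoidHom.ker (show B →+ AddCircle (1 : ℚ) from φ) := by
      intro b hb
      obtain ⟨x, rfl⟩ := (he b).1 hb
      exact DFunLike.congr_fun h x
    refine ⟨(AddMonoidHom.liftOfSurjective g.toAddMonoidHom hg ⟨_, hker⟩ :
      C →+ AddCircle (1 : ℚ)), ?_⟩
    exact AddMonoidHom.liftOfRightInverse_comp g.toAddMonoidHom _ _ ⟨_, hker⟩
  · rintro ⟨ψ, rfl⟩
    ext x
    change ψ (g (f x)) = 0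
    rw [he.apply_apply_eq_zero, map_zero]

lemma charDual_shortExact {A B C : ModuleCat.{u} R} {f : A →ₗ[R] B} {g : B →ₗ[R] C}
    (hf : Function.Injective f) (he : Function.Exact f g) (hg : Function.Surjective g) :
    (ShortComplex.mk (X₁ := charDual C) (X₂ := charDual B) (X₃ := charDual A)
      (ModuleCat.ofHom (CharacterModule.dual g)) (ModuleCat.ofHom (CharacterModule.dual f))
      (ModuleCat.hom_ext (LinearMap.ext
        (CharacterModule.dual_exact he hg).apply_apply_eq_zero))).ShortExact :=
  ModuleCat.shortExact_of_linearMap (A := charDual C) (B := charDual B) (C := charDual A)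
    (CharacterModule.dual_injective_of_surjective g hg)
    (CharacterModule.dual_exact he hg) (CharacterModule.dual_surjective_of_injective f hf)

/-- Exchange of the arguments of a bilinear pairing with values in `ℚ/ℤ`. -/
def CharacterModule.transpose {A B : Type u} [AddCommGroup A] [AddCommGroup B]
    [Module R A] [Module R B] (φ : A →ₗ[R] CharacterModule B) : B →ₗ[R] CharacterModule A where
  toFun b :=
    { toFun := fun a => φ a b
      map_zero' := by rw [map_zero]; rfl
      map_add' := fun a a' => by rw [map_add]; rfl }
  map_add' b b' := by ext a; exact map_add (φ a) b b'
  map_smul' r b := by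
    ext a
    change φ a (r • b) = φ (r • a) b
    rw [LinearMap.map_smul, CharacterModule.smul_apply]

lemma lTensor_injective_iff_dual_lift {A B I : Type u} [AddCommGroup A] [AddCommGroup B]
    [AddCommGroup I] [Module R A] [Module R B] [Module R I] (f : A →ₗ[R] B) :
    Function.Injective (f.lTensor I) ↔
      ∀ φ : I →ₗ[R] CharacterModule A, ∃ ψ : I →ₗ[R] CharacterModule B,
        CharacterModule.dual f ∘ₗ ψ = φ := by
  rw [LinearMap.lTensor_inj_iff_rTensor_inj, rTensor_injective_iff_lcomp_surjective]
  constructor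
  · intro h φ
    obtain ⟨ψ, hψ⟩ := h (CharacterModule.transpose φ)
    refine ⟨CharacterModule.transpose ψ, ?_⟩
    ext i a
    exact DFunLike.congr_fun (LinearMap.congr_fun hψ a) i
  · intro h φ
    obtain ⟨ψ, hψ⟩ := h (CharacterModule.transpose φ)
    refine ⟨CharacterModule.transpose ψ, ?_⟩
    ext a i
    exact DFunLike.congr_fun (LinearMap.congr_fun hψ i) a

lemma flat_iff_injective_charDual (M : ModuleCat.{u} R) :
    Module.Flat R M ↔ Injective (charDual M) := by
  rw [Module.Flat.iff_characterModule_injective]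
  exact Module.injective_iff_injective_object R _

/-- If `Ext¹(I, C⋆) = 0` then `I ⊗ -` preserves the injectivity of monomorphisms with
cokernel `C`. -/
lemma lTensor_injective_of_ext_eq_zero {A B C I : ModuleCat.{u} R} {f : A →ₗ[R] B}
    {g : B →ₗ[R] C} (hf : Function.Injective f) (he : Function.Exact f g)
    (hg : Function.Surjective g) (h : ∀ e : Ext I (charDual C) 1, e = 0) :
    Function.Injective (f.lTensor I) := by
  rw [lTensor_injective_iff_dual_lift]
  intro φ
  obtain ⟨ψ, hψ⟩ := Ext.covariant_sequence_exact₃ I (charDual_shortExact hf he hg)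
    (Ext.mk₀ (ModuleCat.ofHom φ : I ⟶ charDual A)) (zero_add 1) (h _)
  obtain ⟨ψ, rfl⟩ := Ext.homEquiv₀.symm.surjective ψ
  refine ⟨ψ.hom, ?_⟩
  have : ψ ≫ ModuleCat.ofHom (CharacterModule.dual f) = ModuleCat.ofHom φ :=
    Ext.homEquiv₀.symm.injective (by simpa using hψ)
  exact congrArg ModuleCat.Hom.hom this

lemma ext_one_eq_zero_of_lTensor_injective {A B C I : ModuleCat.{u} R} {f : A →ₗ[R] B}
    {g : B →ₗ[R] C} (hf : Function.Injective f) (he : Function.Exact f g)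
    (hg : Function.Surjective g) (hB : ∀ e : Ext I (charDual B) 1, e = 0)
    (h : Function.Injective (f.lTensor I)) (e : Ext I (charDual C) 1) : e = 0 := by
  have hS := charDual_shortExact hf he hg
  obtain ⟨φ, rfl⟩ := Ext.covariant_sequence_exact₁ I hS e (hB _) (zero_add 1)
  obtain ⟨φ, rfl⟩ := Ext.homEquiv₀.symm.surjective φ
  obtain ⟨ψ, hψ⟩ := (lTensor_injective_iff_dual_lift f).1 h φ.hom
  have : φ = ModuleCat.ofHom ψ ≫ ModuleCat.ofHom (CharacterModule.dual f) :=
    ModuleCat.hom_ext hψ.symm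
  rw [this]
  have h0 := hS.comp_extClass
  dsimp at h0 ⊢
  simp only [Ext.homEquiv₀_symm_apply, ← Ext.mk₀_comp_mk₀]
  rw [Ext.comp_assoc _ _ _ (zero_add 0) (zero_add 1) (by simp)]
  erw [h0]
  rw [Ext.comp_zero]

/-- In a short exact sequence with flat middle term, the flat dimension of the kernel is one less
than that of the cokernel. -/
lemma Ses.flatDim_left {A B C : ModuleCat.{u} R} (h : Ses A B C) (hB : Module.Flat R B) {n : ℕ}
    (hC : HasInjectiveDimensionLT (charDual C) (n + 2)) :
    HasInjectiveDimensionLT (charDual A) (n + 1) := by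
  obtain ⟨f, g, hf, he, hg⟩ := h
  have := (flat_iff_injective_charDual B).1 hB
  exact (charDual_shortExact hf he hg).hasInjectiveDimensionLT_X₃ (n + 1)
    (hasInjectiveDimensionLT_of_ge (charDual B) 1 (n + 1) (by lia)) hC

lemma Ses.flatDim_right {A B C : ModuleCat.{u} R} (h : Ses A B C) (hB : Module.Flat R B) {n : ℕ}
    (hA : HasInjectiveDimensionLT (charDual A) (n + 1)) :
    HasInjectiveDimensionLT (charDual C) (n + 2) := by
  obtain ⟨f, g, hf, he, hg⟩ := h
  have := (flat_iff_injective_charDual B).1 hB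
  exact (charDual_shortExact hf he hg).hasInjectiveDimensionLT_X₁ (n + 1) hA
    (hasInjectiveDimensionLT_of_ge (charDual B) 1 (n + 2) (by lia))

lemma Ses.flat_left {A B C : ModuleCat.{u} R} (h : Ses A B C) (hB : Module.Flat R B)
    (hC : Module.Flat R C) : Module.Flat R A := by
  rw [flat_iff_injective_charDual] at hC ⊢
  rw [injective_iff_hasInjectiveDimensionLT_one]
  exact h.flatDim_left (n := 0) hB inferInstance

lemma Ses.flat_mid {A B C : ModuleCat.{u} R} (h : Ses A B C) (hA : Module.Flat R A)
    (hC : Module.Flat R C) : Module.Flat R B := by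
  rw [flat_iff_injective_charDual, injective_iff_hasInjectiveDimensionLT_one] at hA hC ⊢
  obtain ⟨f, g, hf, he, hg⟩ := h
  exact (charDual_shortExact hf he hg).hasInjectiveDimensionLT_X₂ 1 hC hA

/-- The free cover of a module. -/
lemma exists_ses_projective (M : ModuleCat.{u} R) :
    ∃ K P : ModuleCat.{u} R, Module.Projective R P ∧ Ses K P M :=
  ⟨_, ModuleCat.of R (M →₀ R), inferInstance,
    Ses.of_surjective (g := Finsupp.linearCombination R id)
      (Finsupp.linearCombination_id_surjective R M)⟩

/-- Character duals have vanishing `Ext` against flat modules. -/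
lemma ext_charDual_eq_zero_of_flat (n : ℕ) :
    ∀ (F N : ModuleCat.{u} R), Module.Flat R F → ∀ e : Ext F (charDual N) (n + 1), e = 0 := by
  induction n with
  | zero =>
    intro F N hF e
    obtain ⟨K, P, hP, f, g, hf, hfg, hg⟩ := exists_ses_projective F
    have hproj : Projective P := (IsProjective.iff_projective (R := R) P).1 hP
    have hS := ModuleCat.shortExact_of_linearMap hf hfg hg
    obtain ⟨φ, rfl⟩ := Ext.contravariant_sequence_exact₃ hS (charDual N) e
      (Ext.eq_zero_of_projective _) (add_comm _ _)
    obtain ⟨φ, rfl⟩ := Ext.homEquiv₀.symm.surjective φ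
    have hinj : Function.Injective (f.lTensor N) :=
      LinearMap.lTensor_injective_of_exact_of_flat g hg f hf hfg N
    rw [LinearMap.lTensor_inj_iff_rTensor_inj, rTensor_injective_iff_lcomp_surjective] at hinj
    obtain ⟨ψ, hψ⟩ := hinj φ.hom
    have : φ = ModuleCat.ofHom f ≫ ModuleCat.ofHom ψ := ModuleCat.hom_ext hψ.symm
    rw [this, Ext.homEquiv₀_symm_apply, ← Ext.mk₀_comp_mk₀]
    exact hS.extClass_comp_assoc _
  | succ n ih =>
    intro F N hF e
    obtain ⟨K, P, hP, h⟩ := exists_ses_projective F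
    have hproj : Projective P := (IsProjective.iff_projective (R := R) P).1 hP
    obtain ⟨f, g, w, hS⟩ := h.exists_shortExact
    obtain ⟨φ, rfl⟩ := Ext.contravariant_sequence_exact₃ hS (charDual N) e
      (Ext.eq_zero_of_projective _) (add_comm _ _)
    rw [ih _ N (h.flat_left inferInstance hF) φ, Ext.comp_zero]

lemma ext_charDual_eq_zero_of_flatDim (n : ℕ) :
    ∀ (M N : ModuleCat.{u} R), HasInjectiveDimensionLT (charDual M) (n + 1) →
      ∀ (i : ℕ), n < i → ∀ e : Ext M (charDual N) i, e = 0 := by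
  induction n with
  | zero =>
    intro M N hM i hi e
    obtain ⟨i, rfl⟩ := Nat.exists_eq_succ_of_ne_zero hi.ne'
    exact ext_charDual_eq_zero_of_flat i M N
      ((flat_iff_injective_charDual M).2
        (injective_iff_hasInjectiveDimensionLT_one.2 hM)) e
  | succ n ih =>
    intro M N hM i hi e
    obtain ⟨i, rfl⟩ := Nat.exists_eq_succ_of_ne_zero (Nat.ne_zero_of_lt hi)
    obtain ⟨K, P, hP, h⟩ := exists_ses_projective M
    have hK := h.flatDim_left inferInstance hM
    obtain ⟨f, g, w, hS⟩ := h.exists_shortExact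
    have hproj : Projective P := (IsProjective.iff_projective (R := R) P).1 hP
    obtain ⟨φ, rfl⟩ := Ext.contravariant_sequence_exact₃ hS (charDual N) e
      (Ext.eq_zero_of_projective _) (add_comm _ _)
    rw [ih _ N hK _ (by lia) φ, Ext.comp_zero]

/-- `Tor_i(I, M) = 0` for all injective modules `I` and `i > 0`, expressed through the duality
`Tor_i(I, M)⋆ = Ext^i(I, M⋆)`. -/
def TorVanishes (M : ModuleCat.{u} R) : Prop :=
  ∀ I : ModuleCat.{u} R, Injective I → ∀ (i : ℕ) (e : Ext I (charDual M) (i + 1)), e = 0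

lemma TorVanishes.of_flat {M : ModuleCat.{u} R} (h : Module.Flat R M) : TorVanishes M := by
  intro I _ i e
  have := (flat_iff_injective_charDual M).1 h
  exact e.eq_zero_of_injective

lemma Ses.torVanishes_mid {A B C : ModuleCat.{u} R} (h : Ses A B C) (hA : TorVanishes A)
    (hC : TorVanishes C) : TorVanishes B := by
  intro I hI i e
  obtain ⟨f, g, hf, he, hg⟩ := h
  obtain ⟨x, rfl⟩ := Ext.covariant_sequence_exact₂ _ (charDual_shortExact hf he hg) e
    (hA I hI i _)
  rw [hC I hI i x, Ext.zero_comp]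

lemma Ses.torVanishes_left {A B C : ModuleCat.{u} R} (h : Ses A B C) (hB : TorVanishes B)
    (hC : TorVanishes C) : TorVanishes A := by
  intro I hI i e
  obtain ⟨f, g, hf, he, hg⟩ := h
  obtain ⟨x, rfl⟩ := Ext.covariant_sequence_exact₃ _ (charDual_shortExact hf he hg) e rfl
    (hC I hI (i + 1) _)
  rw [hB I hI i x, Ext.zero_comp]

lemma Ses.ext_charDual_eq_zero {A B C I : ModuleCat.{u} R} (h : Ses A B C)
    (hB : Module.Flat R B) {i : ℕ} (hC : ∀ e : Ext I (charDual C) (i + 2), e = 0)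
    (e : Ext I (charDual A) (i + 1)) : e = 0 := by
  obtain ⟨f, g, hf, he, hg⟩ := h
  obtain ⟨x, rfl⟩ := Ext.covariant_sequence_exact₃ _ (charDual_shortExact hf he hg) e rfl (hC _)
  have := (flat_iff_injective_charDual B).1 hB
  rw [x.eq_zero_of_injective, Ext.zero_comp]

lemma Ses.ext_charDual_eq_zero_succ {A B C I : ModuleCat.{u} R} (h : Ses A B C)
    (hB : Module.Flat R B) {i : ℕ} (hA : ∀ e : Ext I (charDual A) (i + 1), e = 0)
    (e : Ext I (charDual C) (i + 2)) : e = 0 := by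
  obtain ⟨f, g, hf, he, hg⟩ := h
  have := (flat_iff_injective_charDual B).1 hB
  obtain ⟨x, rfl⟩ := Ext.covariant_sequence_exact₁ _ (charDual_shortExact hf he hg) e
    (Ext.eq_zero_of_injective _) rfl
  rw [hA x, Ext.zero_comp]

end CharacterDuals

section Noetherian

variable {R : Type u} [CommRing R]

lemma CharacterModule.sum_apply {E ι : Type*} [AddCommGroup E] (s : Finset ι)
    (c : ι → CharacterModule E) (e : E) : (∑ j ∈ s, c j) e = ∑ j ∈ s, c j e := by
  induction s using Finset.cons_induction with
  | empty => rfl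
  | cons i s hi ih => rw [Finset.sum_cons, Finset.sum_cons, ← ih]; rfl

/-- Over a noetherian ring the character module of an injective module is flat. -/
lemma CharacterModule.flat_of_injective [IsNoetherianRing R] (E : Type u) [AddCommGroup E]
    [Module R E] [Module.Injective R E] : Module.Flat R (CharacterModule E) := by
  rw [Module.Flat.iff_forall_isTrivialRelation]
  intro l f x hfx
  let φ : (Fin l → R) →ₗ[R] R := Fintype.linearCombination R f
  have hφ : ∀ v, φ v = ∑ i, v i * f i := fun v => by
    simp [φ, Fintype.linearCombination_apply]
  obtain ⟨k, a, ha⟩ := Submodule.fg_iff_exists_fin_generating_family.1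
    (IsNoetherian.noetherian (LinearMap.ker φ))
  have haφ : ∀ j, φ (a j) = 0 := fun j => by
    have : a j ∈ LinearMap.ker φ := ha ▸ Submodule.subset_span ⟨j, rfl⟩
    exact this
  let δ : (Fin l → E) →ₗ[R] (Fin k → E) :=
    LinearMap.pi fun j => ∑ i, a j i • LinearMap.proj i
  have hδ : ∀ v j, δ v j = ∑ i, a j i • v i := fun v j => by simp [δ]
  let χ : (Fin l → E) →+ AddCircle (1 : ℚ) :=
    ∑ i, AddMonoidHom.comp (show E →+ AddCircle (1 : ℚ) from x i) (Pi.evalAddMonoidHom _ i)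
  have hχ : ∀ v, χ v = ∑ i, x i (v i) := fun v => by
    simp only [χ, AddMonoidHom.finsetSum_apply]; rfl
  have hker : ∀ v, δ v = 0 → χ v = 0 := by
    intro v hv
    let ψ : (Fin l → R) →ₗ[R] E := Fintype.linearCombination R v
    have hψ : ∀ w, ψ w = ∑ i, w i • v i := fun w => by
      simp [ψ, Fintype.linearCombination_apply]
    have hle : LinearMap.ker φ ≤ LinearMap.ker ψ := by
      rw [← ha, Submodule.span_le]
      rintro _ ⟨j, rfl⟩
      change ψ (a j) = 0
      rw [hψ, ← hδ, hv]; rfl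
    let ψ' : LinearMap.range φ →ₗ[R] E :=
      (LinearMap.ker φ).liftQ ψ hle ∘ₗ φ.quotKerEquivRange.symm.toLinearMap
    obtain ⟨h, hh⟩ := Module.Injective.out (LinearMap.range φ).subtype Subtype.val_injective ψ'
    have hhφ : ∀ w, h (φ w) = ψ w := by
      intro w
      have h1 := hh (φ.rangeRestrict w)
      have h2 : φ.quotKerEquivRange.symm (φ.rangeRestrict w) = Submodule.Quotient.mk w := by
        rw [LinearEquiv.symm_apply_eq]; rfl
      simp only [ψ', LinearMap.comp_apply, LinearEquiv.coe_coe, h2] at h1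
      exact h1
    have hv' : ∀ i, v i = f i • h 1 := fun i => by
      have h1 := hhφ (Pi.single i 1)
      rw [hφ, hψ] at h1
      simp only [Pi.single_apply, ite_mul, one_mul, zero_mul, ite_smul, one_smul, zero_smul,
        Finset.sum_ite_eq', Finset.mem_univ, if_true] at h1
      rw [← h1, ← map_smul, smul_eq_mul, mul_one]
    rw [hχ]
    have h0 := DFunLike.congr_fun hfx (h 1)
    simp only [hv']
    rw [CharacterModule.sum_apply] at h0
    exact h0
  obtain ⟨χ', hχ'⟩ := (CharacterModule.dual_exact (LinearMap.exact_subtype_ker_map δ.rangeRestrict)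
    δ.surjective_rangeRestrict χ).1 (by
      ext ⟨v, hv⟩
      exact hker v (congrArg Subtype.val hv))
  obtain ⟨y, rfl⟩ := CharacterModule.dual_surjective_of_injective (LinearMap.range δ).subtype
    Subtype.val_injective χ'
  have hy : ∀ v, y (δ v) = χ v := fun v => DFunLike.congr_fun hχ' v
  refine ⟨k, fun i j => a j i, fun j => CharacterModule.dual (LinearMap.single R (fun _ => E) j) y,
    fun i => ?_, fun j => ?_⟩
  · ext e
    have h1 := hy (Pi.single i e)
    have h2 : χ (Pi.single i e) = x i e := by
      rw [hχ, Finset.sum_eq_single i]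
      · simp
      · intro j _ hj
        rw [Pi.single_eq_of_ne hj, map_zero]
      · simp
    have h3 : δ (Pi.single i e) = ∑ j, Pi.single j (a j i • e) := by
      rw [Finset.univ_sum_single]
      funext j
      rw [hδ, Finset.sum_eq_single i]
      · simp
      · intro i' _ hi'
        rw [Pi.single_eq_of_ne hi', smul_zero]
      · simp
    rw [← h2, ← h1, h3, map_sum]
    rw [CharacterModule.sum_apply]
    rfl
  · rw [← haφ j, hφ]
    exact Finset.sum_congr rfl fun i _ => mul_comm _ _

end Noetherian

section GorensteinFlat

open CategoryTheory.Abelian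

variable {R : Type u} [CommRing R]

/-- Over a noetherian ring, every flat module embeds with flat cokernel into a flat module `J`
such that homomorphisms to `J` extend along monomorphisms with Tor-vanishing cokernel. -/
lemma exists_flat_extension [IsNoetherianRing R] (F : ModuleCat.{u} R) (hF : Module.Flat R F) :
    ∃ (J D : ModuleCat.{u} R) (j : F →ₗ[R] J) (q : J →ₗ[R] D), Module.Flat R J ∧
      Module.Flat R D ∧ Function.Injective j ∧ Function.Exact j q ∧ Function.Surjective q ∧
      ∀ (X G : ModuleCat.{u} R) (i : F →ₗ[R] X) (p : X →ₗ[R] G), Function.Injective i →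
        Function.Exact i p → Function.Surjective p → TorVanishes G →
        ∃ e : X →ₗ[R] J, ∀ x, e (i x) = j x := by
  have hinj : Injective (charDual F) := (flat_iff_injective_charDual F).1 hF
  have : Module.Injective R (CharacterModule F) :=
    (Module.injective_iff_injective_object R _).2 hinj
  let η : F →ₗ[R] charDual (charDual F) := CharacterModule.transpose LinearMap.id
  have hη : Function.Injective η := by
    rw [injective_iff_map_eq_zero]
    intro x hx
    exact CharacterModule.eq_zero_of_character_apply fun c => DFunLike.congr_fun hx c
  have hJ : Module.Flat R (charDual (charDual F)) :=
    CharacterModule.flat_of_injective (CharacterModule F)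
  obtain ⟨D, q, hq⟩ : ∃ (D : ModuleCat.{u} R) (q : charDual (charDual F) →ₗ[R] D),
      Function.Exact η q ∧ Function.Surjective q :=
    ⟨ModuleCat.of R (_ ⧸ LinearMap.range η), (LinearMap.range η).mkQ,
      LinearMap.exact_map_mkQ_range η, Submodule.mkQ_surjective _⟩
  refine ⟨_, D, η, q, hJ, ?_, hη, hq.1, hq.2, ?_⟩
  · have hS := charDual_shortExact hη hq.1 hq.2
    let σ := ShortComplex.Splitting.ofExactOfSection _ hS.exact
      (ModuleCat.ofHom (CharacterModule.transpose LinearMap.id)) (by ext φ x; rfl) hS.mono_f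
    have hJ' := (flat_iff_injective_charDual _).1 hJ
    rw [flat_iff_injective_charDual, injective_iff_hasInjectiveDimensionLT_one]
    let ρ : Retract (charDual D) (charDual (charDual (charDual F))) := ⟨_, σ.r, σ.f_r⟩
    exact ρ.hasInjectiveDimensionLT 1
  · intro X G i p hi hip hp hG
    obtain ⟨ψ, hψ⟩ := (lTensor_injective_iff_dual_lift i).1
      (lTensor_injective_of_ext_eq_zero hi hip hp (hG (charDual F) hinj 0)) LinearMap.id
    refine ⟨CharacterModule.transpose ψ, fun x => ?_⟩
    ext φ
    exact DFunLike.congr_fun (LinearMap.congr_fun hψ φ) x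

/-- A coinductive description of Gorenstein flat modules: `G` has vanishing `Tor` against
injective modules and embeds into a flat module with cokernel of the same kind. -/
def HasFlatCoresolution (G : ModuleCat.{u} R) : Prop :=
  ∃ P : ModuleCat.{u} R → Prop, P G ∧ ∀ X, P X → TorVanishes X ∧
    ∃ T X' : ModuleCat.{u} R, Module.Flat R T ∧ Ses X T X' ∧ P X'

namespace HasFlatCoresolution

lemma torVanishes {G : ModuleCat.{u} R} (h : HasFlatCoresolution G) : TorVanishes G := by
  obtain ⟨P, hG, hP⟩ := h
  exact (hP G hG).1

lemma exists_ses {G : ModuleCat.{u} R} (h : HasFlatCoresolution G) :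
    ∃ T G' : ModuleCat.{u} R, Module.Flat R T ∧ Ses G T G' ∧ HasFlatCoresolution G' := by
  obtain ⟨P, hG, hP⟩ := h
  obtain ⟨-, T, G', hT, hs, hG'⟩ := hP G hG
  exact ⟨T, G', hT, hs, P, hG', hP⟩

lemma of_ses {X T G : ModuleCat.{u} R} (hX : TorVanishes X) (hT : Module.Flat R T)
    (h : Ses X T G) (hG : HasFlatCoresolution G) : HasFlatCoresolution X := by
  refine ⟨fun Y => Y = X ∨ HasFlatCoresolution Y, Or.inl rfl, ?_⟩
  rintro Y (rfl | hY)
  · exact ⟨hX, T, G, hT, h, Or.inr hG⟩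
  · obtain ⟨T', G', hT', hs, hG'⟩ := hY.exists_ses
    exact ⟨hY.torVanishes, T', G', hT', hs, Or.inr hG'⟩

lemma of_flat {F : ModuleCat.{u} R} (hF : Module.Flat R F) : HasFlatCoresolution F := by
  refine ⟨fun X => Module.Flat R X, hF, fun X hX => ⟨.of_flat hX, X, ModuleCat.of R PUnit, hX,
    ⟨LinearMap.id, 0, Function.injective_id, ?_, ?_⟩, inferInstance⟩⟩
  · intro x; simp
  · intro x; exact ⟨0, rfl⟩

lemma exists_ses_left {G : ModuleCat.{u} R} (h : HasFlatCoresolution G) :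
    ∃ T G' : ModuleCat.{u} R, Module.Flat R T ∧ Ses G' T G ∧ HasFlatCoresolution G' := by
  obtain ⟨K, P, hP, hs⟩ := exists_ses_projective G
  exact ⟨P, K, inferInstance, hs,
    of_ses (hs.torVanishes_left (.of_flat inferInstance) h.torVanishes) inferInstance hs h⟩

variable [IsNoetherianRing R]

lemma of_flat_extension {F X G : ModuleCat.{u} R} (hF : Module.Flat R F)
    (h : Ses F X G) (hG : HasFlatCoresolution G) : HasFlatCoresolution X := by
  refine ⟨fun X => ∃ F G : ModuleCat.{u} R, Module.Flat R F ∧ HasFlatCoresolution G ∧ Ses F X G,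
    ⟨F, G, hF, hG, h⟩, ?_⟩
  clear! F X G
  rintro X ⟨F, G, hF, hG, h⟩
  refine ⟨h.torVanishes_mid (.of_flat hF) hG.torVanishes, ?_⟩
  obtain ⟨T, G', hT, hs, hG'⟩ := hG.exists_ses
  obtain ⟨J, D, j, q, hJ, hD, hj, hjq, hq, hext⟩ := exists_flat_extension F hF
  obtain ⟨i, p, hi, hip, hp⟩ := h
  obtain ⟨e, he⟩ := hext X G i p hi hip hp hG.torVanishes
  obtain ⟨Q, h1, h2⟩ := (Ses.of_extension hip hp hj hjq hq he).exists_quotient_of_comp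
    (hs.prod_left J)
  exact ⟨_, Q, Ses.flat_mid
    ⟨LinearMap.inl R J T, LinearMap.snd R J T, LinearMap.inl_injective, .inl_snd,
      LinearMap.snd_surjective⟩ hJ hT, h1, D, G', hD, hG', h2⟩

/-- Closure under extensions. -/
lemma of_extension {G X K : ModuleCat.{u} R} (hG : HasFlatCoresolution G)
    (h : Ses G X K) (hK : HasFlatCoresolution K) : HasFlatCoresolution X := by
  refine ⟨fun X => ∃ G K : ModuleCat.{u} R, HasFlatCoresolution G ∧ HasFlatCoresolution K ∧
    Ses G X K, ⟨G, K, hG, hK, h⟩, ?_⟩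
  clear! G X K
  rintro X ⟨G, K, hG, hK, h⟩
  refine ⟨h.torVanishes_mid hG.torVanishes hK.torVanishes, ?_⟩
  obtain ⟨T₁, G₁, hT₁, hs₁, hG₁⟩ := hG.exists_ses
  obtain ⟨Y, hY₁, hY₂⟩ := h.exists_pushout hs₁
  obtain ⟨T₂, Y', hT₂, hs₂, hY'⟩ := (of_flat_extension hT₁ hY₁ hK).exists_ses
  obtain ⟨D, h1, h2⟩ := hY₂.exists_quotient_of_comp hs₂
  exact ⟨T₂, D, hT₂, h1, G₁, Y', hG₁, hY', h2⟩

/-- The kernel of an epimorphism onto a flat module. -/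
lemma of_ses_flat {M G F : ModuleCat.{u} R} (h : Ses M G F) (hG : HasFlatCoresolution G)
    (hF : Module.Flat R F) : HasFlatCoresolution M := by
  obtain ⟨T, G', hT, hs, hG'⟩ := hG.exists_ses
  obtain ⟨D, h1, h2⟩ := h.exists_quotient_of_comp hs
  exact of_ses (h.torVanishes_left hG.torVanishes (.of_flat hF)) hT h1
    (of_flat_extension hF h2 hG')

end HasFlatCoresolution

section Complexes

lemma Function.Exact.comp_of_surjective_injective {A B C A' C' : Type*} [AddCommGroup C]
    [AddCommGroup C'] {f : A → B} {g : B → C} (h : Function.Exact f g)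
    {p : A' → A} (hp : Function.Surjective p) {i : C →+ C'} (hi : Function.Injective i) :
    Function.Exact (f ∘ p) (i ∘ g) := by
  intro b
  rw [Function.comp_apply, map_eq_zero_iff i hi, h b, hp.range_comp]

lemma exists_int_sequence {α : Type*} (S : α → α → Prop) (hr : ∀ a, ∃ b, S a b)
    (hl : ∀ a, ∃ b, S b a) (a : α) : ∃ Z : ℤ → α, Z 1 = a ∧ ∀ n, S (Z (n + 1)) (Z n) := by
  choose r hr using hr
  choose l hl using hl
  let W : ℤ → α := fun n => match n with
    | Int.ofNat k => l^[k] a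
    | Int.negSucc k => r^[k + 1] a
  have hW : ∀ n, S (W (n + 1)) (W n) := by
    intro n
    match n with
    | Int.ofNat k =>
      change S (l^[k + 1] a) (l^[k] a)
      rw [Function.iterate_succ_apply']
      exact hl _
    | Int.negSucc 0 => exact hr a
    | Int.negSucc (k + 1) =>
      change S (r^[k + 1] a) (r^[k + 1 + 1] a)
      rw [Function.iterate_succ_apply' r (k + 1)]
      exact hr _
  refine ⟨fun n => W (n - 1), rfl, fun n => ?_⟩
  have := hW (n - 1)
  rwa [show n - 1 + 1 = n + 1 - 1 by ring] at this

lemma HasFlatCoresolution.isGorensteinFlat {G : ModuleCat.{u} R} (h : HasFlatCoresolution G) :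
    IsGorensteinFlat R G := by
  obtain ⟨Z, hZ, hS⟩ := exists_int_sequence
    (α := {X : ModuleCat.{u} R // HasFlatCoresolution X})
    (fun A B => ∃ T : ModuleCat.{u} R, Module.Flat R T ∧ Ses A.1 T B.1)
    (fun A => by
      obtain ⟨T, B, hT, hs, hB⟩ := A.2.exists_ses
      exact ⟨⟨B, hB⟩, T, hT, hs⟩)
    (fun A => by
      obtain ⟨T, B, hT, hs, hB⟩ := A.2.exists_ses_left
      exact ⟨⟨B, hB⟩, T, hT, hs⟩) ⟨G, h⟩
  choose T hT f g hf hfg hg using hS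
  let d : ∀ n, T (n + 1) →ₗ[R] T n := fun n => f n ∘ₗ g (n + 1)
  have hd : ∀ n, Function.Exact (d (n + 1)) (d n) := fun n =>
    (hfg (n + 1)).comp_of_surjective_injective (hg (n + 1 + 1))
      (i := (f n).toAddMonoidHom) (hf n)
  let K : ChainComplex (ModuleCat.{u} R) ℤ := ChainComplex.of T (fun n => ModuleCat.ofHom (d n))
    (fun n => ModuleCat.hom_ext (LinearMap.ext (hd n).apply_apply_eq_zero))
  have hKd : ∀ n, K.d (n + 1) n = ModuleCat.ofHom (d n) := fun n =>
    ChainComplex.of_d T (fun n => ModuleCat.ofHom (d n)) n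
  refine ⟨K, hT, fun n => ?_, fun I hI n => ?_, ?_⟩
  · obtain ⟨m, rfl⟩ : ∃ m, n = m + 1 := ⟨n - 1, by ring⟩
    rw [K.exactAt_iff' (m + 1 + 1) (m + 1) m (ComplexShape.prev_eq' _ rfl)
      (ComplexShape.next_eq' _ rfl)]
    rw [ShortComplex.ShortExact.moduleCat_exact_iff_function_exact]
    change Function.Exact (K.d (m + 1 + 1) (m + 1)) (K.d (m + 1) m)
    rw [hKd, hKd]
    exact hd m
  · obtain ⟨m, rfl⟩ : ∃ m, n = m + 1 := ⟨n - 1, by ring⟩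
    rw [HomologicalComplex.exactAt_iff' _ (m + 1 + 1) (m + 1) m (ComplexShape.prev_eq' _ rfl)
      (ComplexShape.next_eq' _ rfl)]
    rw [ShortComplex.ShortExact.moduleCat_exact_iff_function_exact]
    change Function.Exact ((K.d (m + 1 + 1) (m + 1)).hom.lTensor I)
      ((K.d (m + 1) m).hom.lTensor I)
    rw [hKd, hKd]
    change Function.Exact ((d (m + 1)).lTensor I) ((d m).lTensor I)
    simp only [d, LinearMap.lTensor_comp]
    exact (lTensor_exact I (hfg (m + 1)) (hg (m + 1))).comp_of_surjective_injective
      (LinearMap.lTensor_surjective I (hg (m + 1 + 1)))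
      (i := ((f m).lTensor I).toAddMonoidHom)
      (lTensor_injective_of_ext_eq_zero (hf m) (hfg m) (hg m) ((Z m).2.torVanishes I hI 0))
  · have key : ∀ n m, n = m + 1 → Nonempty (K.cycles n ≅ (Z (n + 1)).1) := by
      rintro _ m rfl
      have hex : Function.Exact (f (m + 1)) (d m) :=
        (hfg (m + 1)).comp_of_surjective_injective Function.surjective_id
          (i := (f m).toAddMonoidHom) (hf m)
      have w : ModuleCat.ofHom (f (m + 1)) ≫ K.d (m + 1) m = 0 := by
        rw [hKd]
        exact ModuleCat.hom_ext (LinearMap.ext hex.apply_apply_eq_zero)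
      have hE : (ShortComplex.mk (ModuleCat.ofHom (f (m + 1))) (K.d (m + 1) m) w).Exact := by
        rw [ShortComplex.ShortExact.moduleCat_exact_iff_function_exact]
        change Function.Exact (f (m + 1)) (K.d (m + 1) m)
        rw [hKd]
        exact hex
      have : Mono (ModuleCat.ofHom (f (m + 1))) := (ModuleCat.mono_iff_injective _).2 (hf (m + 1))
      exact ⟨(K.cyclesIsKernel (m + 1) m (ComplexShape.next_eq' _ rfl)).conePointUniqueUpToIso
        (ShortComplex.Exact.fIsKernel hE)⟩
    obtain ⟨e⟩ := key 0 (-1) rfl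
    exact ⟨e ≪≫ eqToIso (congrArg Subtype.val hZ)⟩

lemma IsGorensteinFlat.hasFlatCoresolution [IsNoetherianRing R] {G : ModuleCat.{u} R}
    (h : IsGorensteinFlat R G) : HasFlatCoresolution G := by
  obtain ⟨T, hT, hex, htens, ⟨e⟩⟩ := h
  have hinj : ∀ n, Function.Injective (T.iCycles n) := fun n =>
    (ModuleCat.mono_iff_injective _).1 inferInstance
  have hsurj : ∀ n, Function.Surjective (T.toCycles (n + 1) n) := fun n => by
    have hn : (ComplexShape.down ℤ).next n = n - 1 := ComplexShape.next_eq' _ (by simp)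
    have hp : (ComplexShape.down ℤ).prev n = n + 1 := ComplexShape.prev_eq' _ rfl
    have hS := ((T.exactAt_iff' (n + 1) n (n - 1) hp hn).1 (hex n)).epi_toCycles
    have : Epi (T.toCycles (n + 1) n ≫ (T.cyclesIsoSc' (n + 1) n (n - 1) hp hn).hom) := by
      rw [T.toCycles_cyclesIsoSc'_hom]
      exact hS
    rw [epi_comp_iff_of_isIso] at this
    exact (ModuleCat.epi_iff_surjective _).1 this
  have hd : ∀ n x, T.iCycles n (T.toCycles (n + 1) n x) = T.d (n + 1) n x := fun n x => by
    rw [← ConcreteCategory.comp_apply, T.toCycles_i]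
  have hker : ∀ n, Function.Exact (T.iCycles (n + 1)) (T.d (n + 1) n) := fun n =>
    (ShortComplex.ShortExact.moduleCat_exact_iff_function_exact _).1
      (ShortComplex.exact_of_f_is_kernel (ShortComplex.mk _ _ (T.iCycles_d (n + 1) n))
        (T.cyclesIsKernel (n + 1) n (ComplexShape.next_eq' _ rfl)))
  have hexact : ∀ n, Function.Exact (T.iCycles (n + 1)) (T.toCycles (n + 1) n) := fun n x => by
    rw [← hker n x, ← hd, map_eq_zero_iff _ (hinj n)]
  have hses : ∀ n, Ses (T.cycles (n + 1)) (T.X (n + 1)) (T.cycles n) := fun n =>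
    ⟨_, _, hinj (n + 1), hexact n, hsurj n⟩
  have hlT : ∀ (I : ModuleCat.{u} R), Injective I → ∀ n,
      Function.Injective ((T.iCycles n).hom.lTensor I) := by
    intro I hI n
    rw [injective_iff_map_eq_zero]
    intro t ht
    obtain ⟨s, rfl⟩ := LinearMap.lTensor_surjective (g := (T.toCycles (n + 1) n).hom) I (hsurj n) t
    have hT' := (HomologicalComplex.exactAt_iff' _ (n + 1 + 1) (n + 1) n
      (ComplexShape.prev_eq' _ rfl) (ComplexShape.next_eq' _ rfl)).1 (htens I hI (n + 1))
    rw [ShortComplex.ShortExact.moduleCat_exact_iff_function_exact] at hT'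
    change Function.Exact ((T.d (n + 1 + 1) (n + 1)).hom.lTensor I)
      ((T.d (n + 1) n).hom.lTensor I) at hT'
    rw [← LinearMap.comp_apply, ← LinearMap.lTensor_comp, ← ModuleCat.hom_comp, T.toCycles_i,
      hT' s] at ht
    obtain ⟨r, rfl⟩ := ht
    rw [← LinearMap.comp_apply, ← LinearMap.lTensor_comp, ← ModuleCat.hom_comp, T.d_toCycles]
    simp
  have htor : ∀ (I : ModuleCat.{u} R), Injective I → ∀ (i : ℕ) (n : ℤ)
      (e : Ext I (charDual (T.cycles n)) (i + 1)), e = 0 := by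
    intro I hI i
    induction i with
    | zero =>
      intro n e
      exact ext_one_eq_zero_of_lTensor_injective (hinj (n + 1)) (hexact n) (hsurj n)
        (TorVanishes.of_flat (hT (n + 1)) I hI 0) (hlT I hI (n + 1)) e
    | succ i ih =>
      intro n e
      exact (hses n).ext_charDual_eq_zero_succ (hT (n + 1)) (ih (n + 1)) e
  have hcyc : HasFlatCoresolution (T.cycles 0) := by
    refine ⟨fun X => ∃ n, X = T.cycles n, ⟨0, rfl⟩, ?_⟩
    rintro _ ⟨n, rfl⟩
    refine ⟨fun I hI i => htor I hI i n, T.X n, T.cycles (n - 1), hT n, ?_, n - 1, rfl⟩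
    have := hses (n - 1)
    rwa [sub_add_cancel] at this
  refine hcyc.of_ses_flat (F := ModuleCat.of R PUnit) ⟨e.inv.hom, 0, ?_, ?_, fun x => ⟨0, rfl⟩⟩
    inferInstance
  · exact (ModuleCat.mono_iff_injective e.inv).1 inferInstance
  · intro x
    exact ⟨fun _ => ⟨e.hom.hom x, by simp⟩, fun _ => rfl⟩

end Complexes

end GorensteinFlat

section Dimension

open CategoryTheory.Abelian

variable {R : Type u} [CommRing R]

lemma Ses.gfdimLE_succ {K G M : ModuleCat.{u} R} (h : Ses K G M) (hG : IsGorensteinFlat R G)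
    {n : ℕ} (hK : GFdimLE R n K) : GFdimLE R (n + 1) M := by
  obtain ⟨f, g, w, hS⟩ := h.exists_shortExact
  exact ⟨K, G, f, g, w, hG, hS, hK⟩

/-- A syzygy relation: `Syzygy n M X` says that `X` is an `n`-th syzygy of `M`. -/
inductive Syzygy : ℕ → ModuleCat.{u} R → ModuleCat.{u} R → Prop
  | zero (M : ModuleCat.{u} R) : Syzygy 0 M M
  | succ {n : ℕ} {K P M X : ModuleCat.{u} R} (hP : Module.Projective R P) (h : Ses K P M)
      (hX : Syzygy n K X) : Syzygy (n + 1) M X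

namespace Syzygy

lemma exists_syzygy (n : ℕ) : ∀ M : ModuleCat.{u} R, ∃ X, Syzygy n M X := by
  induction n with
  | zero => exact fun M => ⟨M, .zero M⟩
  | succ n ih =>
    intro M
    obtain ⟨K, P, hP, h⟩ := exists_ses_projective M
    obtain ⟨X, hX⟩ := ih K
    exact ⟨X, .succ hP h hX⟩

lemma exists_horseshoe {n : ℕ} {M X : ModuleCat.{u} R} (hX : Syzygy n M X) :
    ∀ {E Z : ModuleCat.{u} R}, Ses M E Z →
      ∃ X' Y : ModuleCat.{u} R, Ses X X' Y ∧ Syzygy n E X' ∧ Syzygy n Z Y := by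
  induction hX with
  | zero M => exact fun {E Z} h => ⟨E, Z, h, .zero E, .zero Z⟩
  | succ hP hK _ ih =>
    intro E Z h
    obtain ⟨K', P', K'', P'', hP', hP'', h', h'', hs⟩ := h.exists_horseshoe hK
    obtain ⟨X', Y, hXY, hX', hY⟩ := ih hs
    exact ⟨X', Y, hXY, .succ hP' h' hX', .succ hP'' h'' hY⟩

lemma flat {n : ℕ} {M X : ModuleCat.{u} R} (hX : Syzygy n M X)
    (hM : HasInjectiveDimensionLT (charDual M) (n + 1)) : Module.Flat R X := by
  induction hX with
  | zero M => rwa [flat_iff_injective_charDual, injective_iff_hasInjectiveDimensionLT_one]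
  | succ hP h _ ih => exact ih (h.flatDim_left inferInstance hM)

lemma ext_charDual_eq_zero {n : ℕ} {M X : ModuleCat.{u} R} (hX : Syzygy n M X)
    {I : ModuleCat.{u} R} : (∀ i, n < i → ∀ e : Ext I (charDual M) i, e = 0) →
      ∀ (i : ℕ) (e : Ext I (charDual X) (i + 1)), e = 0 := by
  induction hX with
  | zero M => exact fun hM i => hM (i + 1) (by lia)
  | succ hP h _ ih =>
    refine fun hM => ih fun i hi => ?_
    obtain ⟨i, rfl⟩ := Nat.exists_eq_succ_of_ne_zero (Nat.ne_zero_of_lt hi)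
    exact h.ext_charDual_eq_zero inferInstance (hM (i + 2) (by lia))

lemma gfdimLE {n : ℕ} {M X : ModuleCat.{u} R} (hX : Syzygy n M X)
    (h : IsGorensteinFlat R X) : GFdimLE R n M := by
  induction hX with
  | zero M => exact h
  | succ hP hs _ ih =>
    exact hs.gfdimLE_succ (HasFlatCoresolution.of_flat inferInstance).isGorensteinFlat (ih h)

end Syzygy

/-- If the flat dimension of injective modules is at most `n`, then `n`-th syzygies are
Gorenstein flat. -/
lemma Syzygy.hasFlatCoresolution {n : ℕ}
    (hn : ∀ E : ModuleCat.{u} R, Injective E → HasInjectiveDimensionLT (charDual E) (n + 1))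
    {M X : ModuleCat.{u} R} (hX : Syzygy n M X) : HasFlatCoresolution X := by
  refine ⟨fun X => ∃ M, Syzygy n M X, ⟨M, hX⟩, ?_⟩
  rintro X ⟨M, hX⟩
  refine ⟨fun I hI => hX.ext_charDual_eq_zero
    (ext_charDual_eq_zero_of_flatDim n I M (hn I hI)), ?_⟩
  obtain ⟨X', Y, hs, hX', hY⟩ := hX.exists_horseshoe
    (Ses.of_injective ((ModuleCat.mono_iff_injective (Injective.ι M)).1 inferInstance))
  exact ⟨X', Y, hX'.flat (hn _ inferInstance), hs, _, hY⟩

lemma Ses.gfdimLE_left [IsNoetherianRing R] {n : ℕ} {M C F : ModuleCat.{u} R} (h : Ses M C F)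
    (hF : Module.Flat R F) (hC : GFdimLE R n C) : GFdimLE R n M := by
  cases n with
  | zero =>
    exact (HasFlatCoresolution.of_ses_flat h
      (IsGorensteinFlat.hasFlatCoresolution hC) hF).isGorensteinFlat
  | succ n =>
    obtain ⟨K, G, f, g, w, hG, hS, hK⟩ := hC
    obtain ⟨G', h₁, h₂⟩ := (Ses.of_shortExact hS).exists_kernel_of_comp h
    exact h₁.gfdimLE_succ (h₂.gfdimLE_left (n := 0) hF hG) hK

/-- A module of Gorenstein flat dimension at most `n` embeds into a module of flat dimension at
most `n`. -/
lemma GFdimLE.exists_ses [IsNoetherianRing R] {n : ℕ} : ∀ {M : ModuleCat.{u} R}, GFdimLE R n M →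
    ∃ H G : ModuleCat.{u} R, HasInjectiveDimensionLT (charDual H) (n + 1) ∧ Ses M H G ∧
      HasFlatCoresolution G := by
  induction n with
  | zero =>
    intro M hM
    obtain ⟨T, G, hT, hs, hG⟩ := (IsGorensteinFlat.hasFlatCoresolution hM).exists_ses
    rw [flat_iff_injective_charDual, injective_iff_hasInjectiveDimensionLT_one] at hT
    exact ⟨T, G, hT, hs, hG⟩
  | succ n ih =>
    rintro M ⟨K, G, f, g, w, hG, hS, hK⟩
    obtain ⟨H, G₂, hH, hs, hG₂⟩ := ih hK
    obtain ⟨G', h₁, h₂⟩ := (Ses.of_shortExact hS).exists_pushout hs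
    obtain ⟨T, G₃, hT, hs', hG₃⟩ := (hG.hasFlatCoresolution.of_extension h₂ hG₂).exists_ses
    obtain ⟨Q, h₃, h₄⟩ := h₁.exists_quotient_of_comp hs'
    exact ⟨Q, G₃, h₃.flatDim_right hT hH, h₄, hG₃⟩

lemma hasInjectiveDimensionLT_charDual_of_retract {X Y : ModuleCat.{u} R} (ρ : Retract X Y) {n : ℕ}
    (h : HasInjectiveDimensionLT (charDual Y) n) : HasInjectiveDimensionLT (charDual X) n := by
  let ρ' : Retract (charDual X) (charDual Y) :=
    { i := ModuleCat.ofHom (CharacterModule.dual ρ.r.hom)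
      r := ModuleCat.ofHom (CharacterModule.dual ρ.i.hom)
      retract := by
        ext φ x
        exact congrArg φ (ConcreteCategory.congr_hom ρ.retract x) }
  exact ρ'.hasInjectiveDimensionLT n

lemma isCotorsionModule_of_injective {C : ModuleCat.{u} R} (hC : Injective C) :
    IsCotorsionModule R C := by
  intro F E f g w _ hS
  have := hS.mono_f
  exact ⟨_, (hS.splittingOfInjective).s_g⟩

lemma exists_flatDim_of_injective [IsNoetherianRing R] {E : ModuleCat.{u} R} (hE : Injective E)
    {n : ℕ} (h : GFdimLE R n E) : HasInjectiveDimensionLT (charDual E) (n + 1) := by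
  obtain ⟨H, G, hH, ⟨f, g, hf, -, -⟩, -⟩ := h.exists_ses
  have : Mono (ModuleCat.ofHom f) := (ModuleCat.mono_iff_injective _).2 hf
  exact hasInjectiveDimensionLT_charDual_of_retract
    ⟨ModuleCat.ofHom f, Injective.factorThru (𝟙 E) (ModuleCat.ofHom f), by simp⟩ hH

/-- If all injective modules have finite flat dimension, then these dimensions are bounded. -/
lemma exists_forall_flatDim_of_injective
    (h : ∀ E : ModuleCat.{u} R, Injective E → ∃ n, HasInjectiveDimensionLT (charDual E) (n + 1)) :
    ∃ n, ∀ E : ModuleCat.{u} R, Injective E → HasInjectiveDimensionLT (charDual E) (n + 1) := by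
  by_contra! hbad
  choose E hE hbad using hbad
  obtain ⟨m, hm⟩ := h (∏ᶜ E) inferInstance
  exact hbad m (hasInjectiveDimensionLT_charDual_of_retract
    ⟨section_ (Pi.π E m), Pi.π E m, IsSplitEpi.id _⟩ hm)

end Dimension

/-- Over a commutative noetherian ring: if every cotorsion module has finite Gorenstein
flat dimension then every module does; the module-level ingredient: in a short exact
sequence `0 → M → C → F → 0` with `F` flat and `C` of finite Gorenstein flat dimension,
`M` has finite Gorenstein flat dimension. -/
theorem stmt13 (R : Type u) [CommRing R] [IsNoetherianRing R] :
    ((∀ C : ModuleCat.{u} R, IsCotorsionModule R C → ∃ n, GFdimLE R n C) →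
      ∀ M : ModuleCat.{u} R, ∃ n, GFdimLE R n M) ∧
    (∀ (M C F : ModuleCat.{u} R) (f : M ⟶ C) (g : C ⟶ F) (w : f ≫ g = 0),
      Module.Flat R F → (ShortComplex.mk f g w).ShortExact →
      (∃ n, GFdimLE R n C) → ∃ n, GFdimLE R n M) := by
  refine ⟨fun h M => ?_, fun M C F f g w hF hS ⟨n, hC⟩ =>
    ⟨n, (Ses.of_shortExact hS).gfdimLE_left hF hC⟩⟩
  obtain ⟨n, hn⟩ := exists_forall_flatDim_of_injective fun E hE => by
    obtain ⟨n, hn⟩ := h E (isCotorsionModule_of_injective hE)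
    exact ⟨n, exists_flatDim_of_injective hE hn⟩
  obtain ⟨X, hX⟩ := Syzygy.exists_syzygy n M
  exact ⟨n, hX.gfdimLE (hX.hasFlatCoresolution hn).isGorensteinFlat⟩
end
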